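/- arXiv:1801.00419 — 3 statements merged into one kernel-verified Lean document; each statement's English description precedes it below -/
import Mathlib

section
/- Let τ_n be a topology on 𝒪^n(ℱ_n). The topology t_{ℱ_n}(τ_n) on C(Y,Z) is splitting if and only if for every topological space X, the continuity of a map F : X×Y → Z implies the continuity with respect to the first variable of the map F̄_n : X × 𝒪(Z) → 𝒪^n(ℱ_n) defined by F̄_n(x,U) = O^n(F_x⁻¹(U)), where F_x(y) = F(x,y). -/
open TopologicalSpace Set Topology

universe u v w

/-- Iterated stage types: `Stage Y 0 = 𝒪(Y)` and `Stage Y (k+1)` is the type in which the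
level-`(k+1)` objects `O^{k+1}(U)` live. -/
@[reducible] def Stage (Y : Type u) [TopologicalSpace Y] : ℕ → Type u
  | 0 => Opens Y
  | k + 1 => Set (Set (Stage Y k))

/-- `famO F k U` is `O^{k+1}(U)`, where the family `ℱ_{k+1}` is `F k`.
So `famO F 0 U = O¹(U) = {φ ∈ ℱ₁ : U ∈ φ}` and
`famO F (k+1) U = O^{k+2}(U) = {φ ∈ ℱ_{k+2} : O^{k+1}(U) ∈ φ}`. -/
def famO {Y : Type u} [TopologicalSpace Y] (F : ∀ k, Set (Set (Stage Y k))) :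
    ∀ k, Opens Y → Stage Y (k + 1)
  | 0, U => {φ ∈ F 0 | U ∈ φ}
  | k + 1, U => {φ ∈ F (k + 1) | famO F k U ∈ φ}

variable {Y : Type u} [TopologicalSpace Y]

/-- The set `𝒪^{m+1}(ℱ_{m+1}) = {O^{m+1}(U) : U ∈ 𝒪(Y)}`, as a type. -/
abbrev OmegaN (F : ∀ k, Set (Set (Stage Y k))) (m : ℕ) : Type u :=
  {s : Stage Y (m + 1) // s ∈ Set.range (famO F m)}

/-- The map `Φ_{ℱ_{m+1}} : 𝒪(Y) → 𝒪^{m+1}(ℱ_{m+1})`, `U ↦ O^{m+1}(U)`. -/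
def onMap (F : ∀ k, Set (Set (Stage Y k))) (m : ℕ) (U : Opens Y) : OmegaN F m :=
  ⟨famO F m U, Set.mem_range_self U⟩

/-- The `ℱ_{m+1}(τ)`-family-open topology `t_{ℱ_{m+1}}(τ)` on `C(Y, Z)`: it is generated by the
subbasic sets `⟨ℍ, U⟩ = {f ∈ C(Y,Z) : O^{m+1}(f⁻¹(U)) ∈ ℍ}`, `ℍ ∈ τ`, `U ∈ 𝒪(Z)`. -/
def famTop (Z : Type v) [TopologicalSpace Z] {Y : Type u} [TopologicalSpace Y]
    (F : ∀ k, Set (Set (Stage Y k))) (m : ℕ)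
    (τ : TopologicalSpace (OmegaN F m)) : TopologicalSpace C(Y, Z) :=
  TopologicalSpace.generateFrom
    {S | ∃ (H : Set (OmegaN F m)) (U : Opens Z), IsOpen[τ] H ∧
      S = {f : C(Y, Z) | onMap F m (Opens.comap f U) ∈ H}}

/-- A topology `t` on `C(Y, Z)` is splitting if for every topological space `X`, continuity of
`F : X × Y → Z` implies continuity of `F̂ : X → C_t(Y, Z)`, `F̂(x)(y) = F(x, y)`. -/
def IsSplittingTop {Y : Type u} {Z : Type v} [TopologicalSpace Y] [TopologicalSpace Z]
    (t : TopologicalSpace C(Y, Z)) : Prop :=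
  ∀ (X : Type w) [tX : TopologicalSpace X] (Fc : X × Y → Z) (hFc : Continuous Fc),
    Continuous[tX, t] fun x : X =>
      (⟨fun y => Fc (x, y), hFc.comp (Continuous.prodMk_right x)⟩ : C(Y, Z))

/-- A map into `C(Y, Z)` with the family-open topology is continuous iff all the maps
`x ↦ O^{m+1}((g x)⁻¹(U))`, `U ∈ 𝒪(Z)`, are continuous. -/
theorem continuous_famTop_iff {Z : Type v} [TopologicalSpace Z]
    {F : ∀ k, Set (Set (Stage Y k))} {m : ℕ} {τ : TopologicalSpace (OmegaN F m)}
    {X : Type w} {tX : TopologicalSpace X} {g : X → C(Y, Z)} :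
    Continuous[tX, famTop Z F m τ] g ↔
      ∀ U : Opens Z, Continuous[tX, τ] fun x => onMap F m (Opens.comap (g x) U) := by
  refine continuous_generateFrom_iff.trans ⟨fun h U => continuous_def.2 fun H hH => ?_, ?_⟩
  · exact h _ ⟨H, U, hH, rfl⟩
  · rintro h _ ⟨H, U, hH, rfl⟩
    exact hH.preimage (h U)

/-- The topology `t_{ℱ_n}(τ)` on `C(Y,Z)` is splitting iff for every topological space `X`,
continuity of `F : X × Y → Z` implies continuity with respect to the first variable of
`F̄_n : X × 𝒪(Z) → 𝒪^n(ℱ_n)`, `F̄_n(x, U) = O^n(F_x⁻¹(U))` (here `n = m + 1`). -/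
theorem stmt8 (Z : Type v) [TopologicalSpace Z] (F : ∀ k, Set (Set (Stage Y k)))
    (hF : ∀ k, ∀ φ ∈ F (k + 1), ∀ x ∈ φ, x ∈ Set.range (famO F k))
    (m : ℕ) (τ : TopologicalSpace (OmegaN F m)) :
    IsSplittingTop.{u, v, w} (famTop Z F m τ) ↔
      ∀ (X : Type w) [tX : TopologicalSpace X],
        ∀ (Fc : X × Y → Z) (hFc : Continuous Fc) (U : Opens Z),
          Continuous[tX, τ] fun x : X =>
            onMap F m (Opens.comap
              (⟨fun y => Fc (x, y), hFc.comp (Continuous.prodMk_right x)⟩ : C(Y, Z)) U) := by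
  exact forall₄_congr fun _ _ _ _ => continuous_famTop_iff
end

section
/- If the map Φ_{ℱ_n} : 𝒪(Y) → 𝒪^n(ℱ_n), Φ_{ℱ_n}(U) = O^n(U), is continuous when both 𝒪(Y) and 𝒪^n(ℱ_n) carry their Scott topologies (with respect to the inclusion order), then the topology t_{ℱ_n}(τ_Sc(𝒪^n(ℱ_n))) on C(Y,Z) is splitting, for every topological space Z. -/
open TopologicalSpace Set Topology

universe u v w

variable {Y : Type u} [TopologicalSpace Y]

/-- A subset of a poset is Scott open if it is an upper set and every directed set whose
supremum lies in it meets it. -/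
def ScottOpen {P : Type*} [Preorder P] (H : Set P) : Prop :=
  IsUpperSet H ∧ ∀ D : Set P, D.Nonempty → DirectedOn (· ≤ ·) D →
    ∀ a : P, IsLUB D a → a ∈ H → (D ∩ H).Nonempty

/-- The Scott topology on a poset: the Scott open sets form a topology, so the topology
generated by them has exactly the Scott open sets as its open sets. -/
def scottTop (P : Type*) [Preorder P] : TopologicalSpace P :=
  TopologicalSpace.generateFrom {H : Set P | ScottOpen H}

/-- The slice of an open subset of `X × Y` over a point of `X`, as an open subset of `Y`. -/
def openSlice {X : Type*} {Y : Type*} [TopologicalSpace X] [TopologicalSpace Y]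
    (W : Opens (X × Y)) (x : X) : Opens Y :=
  ⟨{y | (x, y) ∈ W}, W.isOpen.preimage (Continuous.prodMk_right x)⟩

/-- The slices of an open subset of `X × Y` depend continuously on the point of `X`, for the
Scott topology on `Opens Y`. -/
theorem continuous_openSlice {X : Type*} {Y : Type*} [tX : TopologicalSpace X]
    [TopologicalSpace Y] (W : Opens (X × Y)) :
    Continuous[tX, scottTop (Opens Y)] (openSlice W) := by
  refine continuous_generateFrom_iff.2 fun H hH => isOpen_iff_mem_nhds.2 fun x₀ hx₀ => ?_
  obtain ⟨hup, hdir⟩ := hH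
  obtain ⟨V, ⟨N, hN, hNV⟩, hVH⟩ := hdir {V : Opens Y | ∃ N ∈ 𝓝 x₀, N ×ˢ (V : Set Y) ⊆ W}
    ⟨⊥, univ, Filter.univ_mem, by simp⟩
    (by
      rintro V₁ ⟨N₁, hN₁, h₁⟩ V₂ ⟨N₂, hN₂, h₂⟩
      refine ⟨V₁ ⊔ V₂, ⟨N₁ ∩ N₂, Filter.inter_mem hN₁ hN₂, ?_⟩, le_sup_left, le_sup_right⟩
      rintro ⟨x, y⟩ ⟨⟨hx₁, hx₂⟩, hy | hy⟩
      · exact h₁ ⟨hx₁, hy⟩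
      · exact h₂ ⟨hx₂, hy⟩)
    (openSlice W x₀)
    ⟨by
      rintro V ⟨N, hN, h⟩ y hy
      exact h ⟨mem_of_mem_nhds hN, hy⟩, by
      intro B hB y hy
      obtain ⟨N, V, hNo, hVo, hxN, hyV, h⟩ := isOpen_prod_iff.1 W.isOpen x₀ y hy
      exact hB (a := ⟨V, hVo⟩) ⟨N, hNo.mem_nhds hxN, h⟩ hyV⟩
    hx₀
  filter_upwards [hN] with x hx
  exact hup (fun y hy => hNV ⟨hx, hy⟩) hVH

/-- If `Φ_{ℱ_n} : 𝒪(Y) → 𝒪^n(ℱ_n)`, `U ↦ O^n(U)`, is Scott continuous, then the topology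
`t_{ℱ_n}(τ_Sc(𝒪^n(ℱ_n)))` on `C(Y,Z)` is splitting for every topological space `Z`
(here `n = m + 1`). -/
theorem stmt10 (F : ∀ k, Set (Set (Stage Y k)))
    (hF : ∀ k, ∀ φ ∈ F (k + 1), ∀ x ∈ φ, x ∈ Set.range (famO F k))
    (m : ℕ)
    (hΦ : Continuous[scottTop (Opens Y), scottTop (OmegaN F m)] (onMap F m)) :
    ∀ (Z : Type v) [TopologicalSpace Z],
      IsSplittingTop.{u, v, w} (famTop Z F m (scottTop (OmegaN F m))) := by
  intro Z _ X tX Fc hFc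
  refine continuous_generateFrom_iff.2 ?_
  rintro _ ⟨H, U, hH, rfl⟩
  exact continuous_def.1 (continuous_openSlice (Opens.comap ⟨Fc, hFc⟩ U)) _
    (continuous_def.1 hΦ H hH)
end

section
/- Let ℱ₁ be a subset of the Scott topology τ_Sc(𝒪(Y)). Then the topology t_{ℱ₁}(τ_Sc(𝒪¹(ℱ₁))) on C(Y,Z), where 𝒪¹(ℱ₁) carries its Scott topology with respect to inclusion, is splitting. -/
open TopologicalSpace Set Topology

universe u v w

/-- `O¹(U) = {φ ∈ ℱ₁ : U ∈ φ}`. -/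
def O1 {Y : Type u} [TopologicalSpace Y] (F1 : Set (Set (Opens Y))) (U : Opens Y) :
    Set (Set (Opens Y)) :=
  {φ ∈ F1 | U ∈ φ}

variable {Y : Type u} [TopologicalSpace Y]

/-- The set `𝒪¹(ℱ₁) = {O¹(U) : U ∈ 𝒪(Y)}`, as a type. -/
abbrev Omega1 (F1 : Set (Set (Opens Y))) : Type u :=
  {s : Set (Set (Opens Y)) // s ∈ Set.range (O1 F1)}

/-- The `ℱ₁(τ)`-family-open topology `t_{ℱ₁}(τ)` on `C(Y, Z)`. -/
def famTop1 (Z : Type v) [TopologicalSpace Z] {Y : Type u} [TopologicalSpace Y]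
    (F1 : Set (Set (Opens Y))) (τ : TopologicalSpace (Omega1 F1)) : TopologicalSpace C(Y, Z) :=
  TopologicalSpace.generateFrom
    {S | ∃ (H : Set (Omega1 F1)) (U : Opens Z), IsOpen[τ] H ∧
      S = {f : C(Y, Z) |
        (⟨O1 F1 (Opens.comap f U), Set.mem_range_self _⟩ : Omega1 F1) ∈ H}}

/-- For `ℱ₁` consisting of Scott open families, `O¹ : 𝒪(Y) → 𝒪¹(ℱ₁)` is Scott continuous, so
preimages of Scott open sets are Scott open. -/
theorem ScottOpen.preimage_O1 {F1 : Set (Set (Opens Y))} (hF1 : ∀ φ ∈ F1, ScottOpen φ)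
    {H : Set (Omega1 F1)} (hH : ScottOpen H) :
    ScottOpen {V : Opens Y | (⟨O1 F1 V, Set.mem_range_self V⟩ : Omega1 F1) ∈ H} := by
  have mono : Monotone fun V : Opens Y => (⟨O1 F1 V, Set.mem_range_self V⟩ : Omega1 F1) :=
    fun V V' hV φ hφ => ⟨hφ.1, (hF1 φ hφ.1).1 hV hφ.2⟩
  refine ⟨fun V V' hV hVH => hH.1 (mono hV) hVH, fun D hne hD a ha haH => ?_⟩
  have hlub : IsLUB ((fun V : Opens Y => (⟨O1 F1 V, Set.mem_range_self V⟩ : Omega1 F1)) '' D)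
      ⟨O1 F1 a, Set.mem_range_self a⟩ := by
    refine ⟨mono.mem_upperBounds_image ha.1, fun b hb φ hφ => ?_⟩
    obtain ⟨V, hVD, hVφ⟩ := (hF1 φ hφ.1).2 D hne hD a ha hφ.2
    exact hb (Set.mem_image_of_mem _ hVD) ⟨hφ.1, hVφ⟩
  obtain ⟨_, ⟨V, hVD, rfl⟩, hVH⟩ := hH.2 _ (hne.image _)
    (hD.mono_comp (fun _ _ h => mono h)) _ hlub haH
  exact ⟨V, hVD, hVH⟩

/-- If `K` is a Scott open family of open sets of `Y` and `W` is open in `X × Y`, then the set of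
points of `X` whose slice of `W` belongs to `K` is open. -/
theorem ScottOpen.isOpen_setOf_slice_mem {X : Type w} [TopologicalSpace X] {K : Set (Opens Y)}
    (hK : ScottOpen K) (W : Opens (X × Y)) :
    IsOpen {x : X | Opens.comap ⟨fun y => (x, y), Continuous.prodMk_right x⟩ W ∈ K} := by
  rw [isOpen_iff_mem_nhds]
  intro x₀ hx₀
  let D : Set (Opens Y) := {V | ∃ N ∈ 𝓝 x₀, N ×ˢ (V : Set Y) ⊆ W}
  have hne : D.Nonempty := ⟨⊥, Set.univ, Filter.univ_mem, by simp⟩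
  have hD : DirectedOn (· ≤ ·) D := by
    rintro V ⟨N, hN, hNV⟩ V' ⟨N', hN', hNV'⟩
    refine ⟨V ⊔ V', ⟨N ∩ N', Filter.inter_mem hN hN', ?_⟩, le_sup_left, le_sup_right⟩
    rintro ⟨x, y⟩ ⟨⟨hx, hx'⟩, hy | hy⟩
    · exact hNV ⟨hx, hy⟩
    · exact hNV' ⟨hx', hy⟩
  have hlub : IsLUB D (Opens.comap ⟨fun y => (x₀, y), Continuous.prodMk_right x₀⟩ W) := by
    constructor
    · rintro V ⟨N, hN, hNV⟩ y hy
      exact hNV ⟨mem_of_mem_nhds hN, hy⟩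
    · intro B hB y hy
      obtain ⟨N, V, hN, hV, hxN, hyV, hNV⟩ := isOpen_prod_iff.1 W.isOpen x₀ y hy
      exact hB (show (⟨V, hV⟩ : Opens Y) ∈ D from ⟨N, hN.mem_nhds hxN, hNV⟩) hyV
  obtain ⟨V, ⟨N, hN, hNV⟩, hVK⟩ := hK.2 D hne hD _ hlub hx₀
  filter_upwards [hN] with x hx
  exact hK.1 (fun y hy => hNV ⟨hx, hy⟩) hVK

/-- The sets that are open in `scottTop P` are exactly the Scott open ones. -/
theorem isOpen_scottTop_iff {P : Type*} [Preorder P] {H : Set P} :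
    IsOpen[scottTop P] H ↔ ScottOpen H := by
  refine ⟨fun h => ?_, fun h => .basic _ h⟩
  induction h with
  | basic _ h => exact h
  | univ => exact ⟨isUpperSet_univ, fun D hne _ _ _ _ => by simpa using hne⟩
  | inter s t _ _ hs ht =>
    refine ⟨hs.1.inter ht.1, fun D hne hD a ha haH => ?_⟩
    obtain ⟨b, hbD, hbs⟩ := hs.2 D hne hD a ha haH.1
    obtain ⟨c, hcD, hct⟩ := ht.2 D hne hD a ha haH.2
    obtain ⟨d, hdD, hbd, hcd⟩ := hD b hbD c hcD
    exact ⟨d, hdD, hs.1 hbd hbs, ht.1 hcd hct⟩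
  | sUnion S _ hS =>
    refine ⟨isUpperSet_sUnion fun s hs => (hS s hs).1, fun D hne hD a ha ⟨s, hsS, has⟩ => ?_⟩
    obtain ⟨b, hbD, hbs⟩ := (hS s hsS).2 D hne hD a ha has
    exact ⟨b, hbD, s, hsS, hbs⟩

/-- If `ℱ₁ ⊆ τ_Sc(𝒪(Y))`, then the topology `t_{ℱ₁}(τ_Sc(𝒪¹(ℱ₁)))` on `C(Y,Z)` is
splitting. -/
theorem stmt14 {Z : Type v} [TopologicalSpace Z] (F1 : Set (Set (Opens Y)))
    (hF1 : ∀ φ ∈ F1, ScottOpen φ) :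
    IsSplittingTop.{u, v, w} (famTop1 Z F1 (scottTop (Omega1 F1))) := by
  intro X _ Fc hFc
  refine continuous_generateFrom_iff.2 ?_
  rintro _ ⟨H, U, hH, rfl⟩
  exact (ScottOpen.preimage_O1 hF1 (isOpen_scottTop_iff.1 hH)).isOpen_setOf_slice_mem
    (Opens.comap ⟨Fc, hFc⟩ U)
end
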